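/- Let F : ℝ² → ℝ be a smooth function satisfying ΔF + F = 0, let z ∈ ℝ² and let r > 0 be such that J₀(r) ≠ 0. Suppose F(x) ≠ 0 for every x ∈ ℝ² with |x − z| = r. Then F(z) ≠ 0 and F(x) · F(z) · J₀(r) > 0 for every x with |x − z| = r. In particular, if r lies strictly between the (k−1)-th and k-th positive zeros of J₀ (with the convention j_{0,0} = 0), then the sign of F on the circle |x − z| = r is opposite to the sign of F(z) when k is even and equal to the sign of F(z) when k is odd. -/

import Mathlib

open Metric intervalIntegral

/-- The Bessel function of the first kind of integer order `n`:
`J_n(s) = (1/π) ∫₀^π cos (n θ - s sin θ) dθ`. -/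
noncomputable def besselJ (n : ℕ) (s : ℝ) : ℝ :=
  (1 / Real.pi) * ∫ θ in (0:ℝ)..Real.pi, Real.cos (n * θ - s * Real.sin θ)

/-- `besselJZero n k` is the `k`-th smallest positive zero of `J_n` (with the
convention `besselJZero n 0 = 0`). -/
noncomputable def besselJZero (n : ℕ) : ℕ → ℝ
  | 0 => 0
  | k + 1 => sInf {r : ℝ | besselJZero n k < r ∧ besselJ n r = 0}

/-- The Euclidean Laplacian of a function on the plane. -/
noncomputable def laplacian (f : EuclideanSpace ℝ (Fin 2) → ℝ)
    (x : EuclideanSpace ℝ (Fin 2)) : ℝ :=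
  ∑ i : Fin 2, fderiv ℝ (fun y => fderiv ℝ f y (EuclideanSpace.single i 1)) x
    (EuclideanSpace.single i 1)


open MeasureTheory Set Filter Topology

abbrev PlaneE := EuclideanSpace ℝ (Fin 2)

/-- Solutions of the radial Bessel equation of order zero, regular at the origin. -/
def Bes (M M' : ℝ → ℝ) : Prop :=
  (∀ t, HasDerivAt M (M' t) t) ∧ Continuous M' ∧ M' 0 = 0 ∧
    ∀ t, 0 < t → HasDerivAt M' (-(M' t) / t - M t) t

/-- Parametrization of circles. -/
noncomputable def circ (z : PlaneE) (p t : ℝ) : PlaneE :=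
  z + (p * Real.cos t) • EuclideanSpace.single (0 : Fin 2) (1 : ℝ)
    + (p * Real.sin t) • EuclideanSpace.single (1 : Fin 2) (1 : ℝ)

lemma circ_cont (z : PlaneE) : Continuous (fun q : ℝ × ℝ => circ z q.1 q.2) := by
  unfold circ; fun_prop

lemma hasDerivAt_param {Φ Φ' : ℝ → ℝ → ℝ} (hc : Continuous (fun q : ℝ × ℝ => Φ q.1 q.2))
    (hc' : Continuous (fun q : ℝ × ℝ => Φ' q.1 q.2))
    (hd : ∀ p t, HasDerivAt (fun p => Φ p t) (Φ' p t) p) (a b p : ℝ) :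
    HasDerivAt (fun p => ∫ t in a..b, Φ p t) (∫ t in a..b, Φ' p t) p := by
  have hK : IsCompact (Icc (p-1) (p+1) ×ˢ uIcc a b) := isCompact_Icc.prod isCompact_uIcc
  obtain ⟨C, hC⟩ := hK.exists_bound_of_continuousOn hc'.continuousOn
  have h1 : ∀ p, Continuous (Φ p) := fun p => hc.comp (by fun_prop : Continuous fun t : ℝ => (p, t))
  have h2 : ∀ p, Continuous (Φ' p) := fun p => hc'.comp (by fun_prop : Continuous fun t : ℝ => (p, t))
  refine (intervalIntegral.hasDerivAt_integral_of_dominated_loc_of_deriv_le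
    (s := Icc (p-1) (p+1)) (bound := fun _ => C) (F := Φ) (F' := Φ')
    (Icc_mem_nhds (by linarith) (by linarith)) ?_ ?_ ?_ ?_ ?_ ?_).2
  · exact Eventually.of_forall fun p => (h1 p).aestronglyMeasurable
  · exact (h1 p).intervalIntegrable _ _
  · exact (h2 p).aestronglyMeasurable
  · refine Eventually.of_forall fun t ht x hx => hC (x, t) ⟨hx, uIoc_subset_uIcc ht⟩
  · exact intervalIntegrable_const
  · exact Eventually.of_forall fun t _ x _ => hd x t

lemma circ_deriv_p {g : PlaneE → ℝ} (hg : Differentiable ℝ g) (z : PlaneE) (p t : ℝ) :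
    HasDerivAt (fun p => g (circ z p t))
      (Real.cos t * fderiv ℝ g (circ z p t) (EuclideanSpace.single 0 1)
        + Real.sin t * fderiv ℝ g (circ z p t) (EuclideanSpace.single 1 1)) p := by
  have h : HasDerivAt (fun p => circ z p t)
      ((1 * Real.cos t) • EuclideanSpace.single (0 : Fin 2) (1 : ℝ)
      + (1 * Real.sin t) • EuclideanSpace.single (1 : Fin 2) (1 : ℝ)) p := by
    unfold circ
    exact ((((hasDerivAt_id p).mul_const _).smul_const _).const_add z).add
      (((hasDerivAt_id p).mul_const _).smul_const _)
  have := (hg (circ z p t)).hasFDerivAt.comp_hasDerivAt p h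
  refine HasDerivAt.congr_deriv (this) ?_
  simp

lemma circ_deriv_t {g : PlaneE → ℝ} (hg : Differentiable ℝ g) (z : PlaneE) (p t : ℝ) :
    HasDerivAt (fun t => g (circ z p t))
      (p * (-Real.sin t * fderiv ℝ g (circ z p t) (EuclideanSpace.single 0 1)
        + Real.cos t * fderiv ℝ g (circ z p t) (EuclideanSpace.single 1 1))) t := by
  have h : HasDerivAt (fun t => circ z p t)
      ((p * -Real.sin t) • EuclideanSpace.single (0 : Fin 2) (1 : ℝ)
      + (p * Real.cos t) • EuclideanSpace.single (1 : Fin 2) (1 : ℝ)) t := by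
    unfold circ
    exact ((((Real.hasDerivAt_cos t).const_mul p).smul_const _).const_add z).add
      (((Real.hasDerivAt_sin t).const_mul p).smul_const _)
  have := (hg (circ z p t)).hasFDerivAt.comp_hasDerivAt t h
  refine HasDerivAt.congr_deriv (this) ?_
  simp
  ring

lemma contDiff_partial {F : PlaneE → ℝ} (hF : ContDiff ℝ (⊤ : ℕ∞) F) (v : PlaneE) :
    ContDiff ℝ (⊤ : ℕ∞) (fun y => fderiv ℝ F y v) :=
  (hF.fderiv_right (m := (⊤ : ℕ∞)) (by simp)).clm_apply contDiff_const

lemma cont_circ_comp {g : PlaneE → ℝ} (hg : Continuous g) (z : PlaneE) :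
    Continuous (fun q : ℝ × ℝ => g (circ z q.1 q.2)) := hg.comp (circ_cont z)

lemma mean_bes {F : PlaneE → ℝ} (hF : ContDiff ℝ (⊤ : ℕ∞) F)
    (hEq : ∀ x, laplacian F x + F x = 0) (z : PlaneE) :
    ∃ M', Bes (fun p => ∫ t in (0:ℝ)..(2 * Real.pi), F (circ z p t)) M' := by
  set a : PlaneE → ℝ := fun y => fderiv ℝ F y (EuclideanSpace.single 0 1) with ha
  set b : PlaneE → ℝ := fun y => fderiv ℝ F y (EuclideanSpace.single 1 1) with hb
  have hac : ContDiff ℝ (⊤ : ℕ∞) a := contDiff_partial hF _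
  have hbc : ContDiff ℝ (⊤ : ℕ∞) b := contDiff_partial hF _
  set a0 : PlaneE → ℝ := fun y => fderiv ℝ a y (EuclideanSpace.single 0 1) with ha0
  set a1 : PlaneE → ℝ := fun y => fderiv ℝ a y (EuclideanSpace.single 1 1) with ha1
  set b0 : PlaneE → ℝ := fun y => fderiv ℝ b y (EuclideanSpace.single 0 1) with hb0
  set b1 : PlaneE → ℝ := fun y => fderiv ℝ b y (EuclideanSpace.single 1 1) with hb1
  have hlap : ∀ y, a0 y + b1 y + F y = 0 := by
    intro y
    have := hEq y
    simp only [laplacian, Fin.sum_univ_two] at this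
    exact this
  have dF : Differentiable ℝ F := hF.differentiable (by simp)
  have da : Differentiable ℝ a := hac.differentiable (by simp)
  have db : Differentiable ℝ b := hbc.differentiable (by simp)
  have cF := cont_circ_comp hF.continuous z
  have ca := cont_circ_comp hac.continuous z
  have cb := cont_circ_comp hbc.continuous z
  have ca0 := cont_circ_comp (contDiff_partial hac (EuclideanSpace.single 0 1)).continuous z
  have ca1 := cont_circ_comp (contDiff_partial hac (EuclideanSpace.single 1 1)).continuous z
  have cb0 := cont_circ_comp (contDiff_partial hbc (EuclideanSpace.single 0 1)).continuous z
  have cb1 := cont_circ_comp (contDiff_partial hbc (EuclideanSpace.single 1 1)).continuous z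
  set Φ1 : ℝ → ℝ → ℝ := fun p t => Real.cos t * a (circ z p t) + Real.sin t * b (circ z p t) with hΦ1
  set Φ2 : ℝ → ℝ → ℝ := fun p t =>
    Real.cos t * (Real.cos t * a0 (circ z p t) + Real.sin t * a1 (circ z p t))
    + Real.sin t * (Real.cos t * b0 (circ z p t) + Real.sin t * b1 (circ z p t)) with hΦ2
  have c1 : Continuous (fun q : ℝ × ℝ => Φ1 q.1 q.2) := by
    simp only [hΦ1]
    exact ((Real.continuous_cos.comp continuous_snd).mul ca).add
      ((Real.continuous_sin.comp continuous_snd).mul cb)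
  have c2 : Continuous (fun q : ℝ × ℝ => Φ2 q.1 q.2) := by
    simp only [hΦ2]
    exact ((Real.continuous_cos.comp continuous_snd).mul
      (((Real.continuous_cos.comp continuous_snd).mul ca0).add
        ((Real.continuous_sin.comp continuous_snd).mul ca1))).add
      ((Real.continuous_sin.comp continuous_snd).mul
      (((Real.continuous_cos.comp continuous_snd).mul cb0).add
        ((Real.continuous_sin.comp continuous_snd).mul cb1)))
  have d1 : ∀ p t, HasDerivAt (fun p => F (circ z p t)) (Φ1 p t) p :=
    fun p t => circ_deriv_p dF z p t
  have d2 : ∀ p t, HasDerivAt (fun p => Φ1 p t) (Φ2 p t) p := fun p t =>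
    ((circ_deriv_p da z p t).const_mul _).add ((circ_deriv_p db z p t).const_mul _)
  have slice : ∀ {Φ : ℝ → ℝ → ℝ}, Continuous (fun q : ℝ × ℝ => Φ q.1 q.2) → ∀ p, 
      IntervalIntegrable (Φ p) volume 0 (2 * Real.pi) := by
    intro Φ h p
    exact (h.comp (by fun_prop : Continuous fun t : ℝ => (p, t))).intervalIntegrable _ _
  have D1 := hasDerivAt_param cF c1 d1 0 (2 * Real.pi)
  have D2 := hasDerivAt_param c1 c2 d2 0 (2 * Real.pi)
  refine ⟨fun p => ∫ t in (0:ℝ)..(2 * Real.pi), Φ1 p t, D1, ?_, ?_, ?_⟩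
  · exact continuous_iff_continuousAt.2 fun p => (D2 p).continuousAt
  · have : ∀ t, Φ1 0 t = Real.cos t * a z + Real.sin t * b z := by
      intro t; simp [hΦ1, circ]
    simp only [this]
    rw [intervalIntegral.integral_add (by apply Continuous.intervalIntegrable; fun_prop)
      (by apply Continuous.intervalIntegrable; fun_prop)]
    simp
  · intro p hp
    refine HasDerivAt.congr_deriv (D2 p) ?_
    set G : ℝ → ℝ := fun t => -Real.sin t * a (circ z p t) + Real.cos t * b (circ z p t) with hG
    set G' : ℝ → ℝ := fun t => p * (-F (circ z p t) - Φ2 p t) - Φ1 p t with hG'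
    have dG : ∀ t, HasDerivAt G (G' t) t := by
      intro t
      have := ((Real.hasDerivAt_sin t).neg.mul (circ_deriv_t da z p t)).add
        ((Real.hasDerivAt_cos t).mul (circ_deriv_t db z p t))
      refine HasDerivAt.congr_deriv (this) ?_
      have e1 : fderiv ℝ a (circ z p t) (EuclideanSpace.single 0 1) = a0 (circ z p t) := rfl
      have e2 : fderiv ℝ a (circ z p t) (EuclideanSpace.single 1 1) = a1 (circ z p t) := rfl
      have e3 : fderiv ℝ b (circ z p t) (EuclideanSpace.single 0 1) = b0 (circ z p t) := rfl
      have e4 : fderiv ℝ b (circ z p t) (EuclideanSpace.single 1 1) = b1 (circ z p t) := rfl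
      rw [e1, e2, e3, e4]
      simp only [hG', hΦ1, hΦ2]
      have hl := hlap (circ z p t)
      have hs := Real.sin_sq_add_cos_sq t
      have hF' : F (circ z p t) = -(a0 (circ z p t) + b1 (circ z p t)) := by linarith
      rw [hF']
      generalize a0 (circ z p t) = A0 at *
      generalize b1 (circ z p t) = B1 at *
      simp only [Pi.neg_apply]
      linear_combination (p * (A0 + B1)) * hs
    have iF := slice (Φ := fun p t => F (circ z p t)) cF p
    have iFn : IntervalIntegrable (fun t => -F (circ z p t)) volume 0 (2 * Real.pi) := iF.neg
    have i1 := slice (Φ := Φ1) c1 p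
    have i2 := slice (Φ := Φ2) c2 p
    have hint : ∫ t in (0:ℝ)..(2 * Real.pi), G' t = G (2 * Real.pi) - G 0 :=
      intervalIntegral.integral_eq_sub_of_hasDerivAt (fun t _ => dG t)
        (((iFn.sub i2).const_mul p).sub i1)
    have hG0 : G (2 * Real.pi) - G 0 = 0 := by simp [hG, circ]
    rw [hG0] at hint
    simp only [hG'] at hint
    rw [intervalIntegral.integral_sub ((iFn.sub i2).const_mul p) i1,
      intervalIntegral.integral_const_mul, intervalIntegral.integral_sub iFn i2,
      intervalIntegral.integral_neg] at hint
    beta_reduce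
    field_simp
    linarith

lemma Bes.lin {M M' N N' : ℝ → ℝ} (h : Bes M M') (k : Bes N N') (c : ℝ) :
    Bes (fun t => M t - c * N t) (fun t => M' t - c * N' t) := by
  refine ⟨fun t => (h.1 t).sub ((k.1 t).const_mul c), h.2.1.sub (continuous_const.mul k.2.1), ?_, ?_⟩
  · simp [h.2.2.1, k.2.2.1]
  · intro t ht
    refine HasDerivAt.congr_deriv ((h.2.2.2 t ht).sub ((k.2.2.2 t ht).const_mul c)) ?_
    ring

lemma Bes.cont {M M' : ℝ → ℝ} (h : Bes M M') : Continuous M :=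
  continuous_iff_continuousAt.2 fun p => (h.1 p).continuousAt

lemma Bes.energy {M M' : ℝ → ℝ} (h : Bes M M') (t : ℝ) (ht : 0 < t) :
    HasDerivAt (fun t => M t ^ 2 + M' t ^ 2) (-2 * M' t ^ 2 / t) t := by
  refine HasDerivAt.congr_deriv (((h.1 t).pow 2).add ((h.2.2.2 t ht).pow 2)) ?_
  field_simp
  ring

lemma Bes.zero {M M' : ℝ → ℝ} (h : Bes M M') (h0 : M 0 = 0) (t : ℝ) (ht : 0 ≤ t) : M t = 0 := by
  have hc := h.cont
  have hc' := h.2.1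
  have : AntitoneOn (fun t => M t ^ 2 + M' t ^ 2) (Ici 0) := by
    apply antitoneOn_of_deriv_nonpos (convex_Ici 0) (by fun_prop)
    · intro x hx
      rw [interior_Ici] at hx
      exact (h.energy x hx).differentiableAt.differentiableWithinAt
    · intro x hx
      rw [interior_Ici] at hx
      have hx : 0 < x := hx
      rw [(h.energy x hx).deriv, div_nonpos_iff]
      right; constructor <;> nlinarith [sq_nonneg (M' x)]
  have := this (mem_Ici.2 le_rfl) (mem_Ici.2 ht) ht
  simp only [h0, h.2.2.1] at this
  nlinarith [sq_nonneg (M' t), sq_nonneg (M t)]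

lemma Bes.simple {M M' : ℝ → ℝ} (h : Bes M M') (h0 : M 0 ≠ 0) (s : ℝ) (hs : 0 < s)
    (hM : M s = 0) : M' s ≠ 0 := by
  intro hM'
  apply h0
  have hc := h.cont
  have hc' := h.2.1
  have hd : ∀ x, 0 < x → HasDerivAt (fun t => t ^ 2 * (M t ^ 2 + M' t ^ 2)) (2 * x * M x ^ 2) x := by
    intro x hx
    refine HasDerivAt.congr_deriv (((hasDerivAt_id x).pow 2).mul (h.energy x hx)) ?_
    simp
    field_simp
    ring
  have hm : MonotoneOn (fun t => t ^ 2 * (M t ^ 2 + M' t ^ 2)) (Ici 0) := by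
    apply monotoneOn_of_deriv_nonneg (convex_Ici 0) (by fun_prop)
    · intro x hx
      rw [interior_Ici] at hx
      exact (hd x hx).differentiableAt.differentiableWithinAt
    · intro x hx
      rw [interior_Ici] at hx
      have hx : 0 < x := hx
      rw [(hd x hx).deriv]
      positivity
  have hz : ∀ x ∈ Ioo 0 s, M x = 0 := by
    intro x hx
    have := hm (mem_Ici.2 hx.1.le) (mem_Ici.2 hs.le) hx.2.le
    simp only [hM, hM'] at this
    have h2 : 0 < x ^ 2 := by have := hx.1; positivity
    have h3 : M x ^ 2 + M' x ^ 2 ≤ 0 := by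
      by_contra hh
      push Not at hh
      nlinarith [mul_pos h2 hh]
    nlinarith [sq_nonneg (M' x), sq_nonneg (M x)]
  have hcl : closure (Ioo 0 s) ⊆ {x | M x = 0} :=
    closure_minimal hz (isClosed_eq hc continuous_const)
  rw [closure_Ioo hs.ne] at hcl
  exact hcl ⟨le_rfl, hs.le⟩

/-- Sturm comparison: no positive solution on `[a, a + π]`. -/
lemma Bes.sturm {M M' : ℝ → ℝ} (h : Bes M M') (a : ℝ) (ha : 0 < a)
    (hpos : ∀ x, a ≤ x → 0 < M x) : False := by
  have hd : ∀ x, 0 < x → HasDerivAt (fun t => (√t * M' t + M t / (2 * √t)) * Real.sin (t - a)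
      - √t * M t * Real.cos (t - a)) (-(M x / (4 * x * √x)) * Real.sin (x - a)) x := by
    intro x hx
    have hs : HasDerivAt (fun t => √t) (1 / (2 * √x)) x := Real.hasDerivAt_sqrt hx.ne'
    have hsx : 0 < √x := Real.sqrt_pos.2 hx
    have hsin : HasDerivAt (fun t => Real.sin (t - a)) (Real.cos (x - a)) x := by
      simpa using ((hasDerivAt_id x).sub_const a).sin
    have hcos : HasDerivAt (fun t => Real.cos (t - a)) (-Real.sin (x - a)) x := by
      simpa using ((hasDerivAt_id x).sub_const a).cos
    have := (((hs.mul (h.2.2.2 x hx)).add ((h.1 x).div (hs.const_mul 2) (by positivity))).mul hsin).sub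
      ((hs.mul (h.1 x)).mul hcos)
    refine HasDerivAt.congr_deriv (this) ?_
    have hxx : x = √x ^ 2 := (Real.sq_sqrt hx.le).symm
    simp only [Pi.mul_apply, Pi.add_apply, Pi.div_apply]
    generalize Real.sin (x - a) = S
    generalize Real.cos (x - a) = C
    generalize M x = m
    generalize M' x = m'
    generalize √x = y at *
    subst hxx
    field_simp
    ring
  have hanti : AntitoneOn (fun t => (√t * M' t + M t / (2 * √t)) * Real.sin (t - a)
      - √t * M t * Real.cos (t - a)) (Icc a (a + Real.pi)) := by
    apply antitoneOn_of_deriv_nonpos (convex_Icc _ _)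
    · intro x hx
      exact (hd x (by linarith [hx.1])).continuousAt.continuousWithinAt
    · intro x hx
      rw [interior_Icc] at hx
      exact (hd x (by linarith [hx.1])).differentiableAt.differentiableWithinAt
    · intro x hx
      rw [interior_Icc] at hx
      have hx0 : 0 < x := by linarith [hx.1]
      rw [(hd x hx0).deriv]
      have h1 := hpos x hx.1.le
      have h2 : 0 < Real.sin (x - a) := Real.sin_pos_of_pos_of_lt_pi (by linarith [hx.1]) (by linarith [hx.2])
      have : 0 ≤ M x / (4 * x * √x) * Real.sin (x - a) := by positivity
      linarith
  have hpi := Real.pi_pos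
  have := hanti (left_mem_Icc.2 (by linarith)) (right_mem_Icc.2 (by linarith)) (by linarith)
  simp at this
  have h1 : 0 < √a * M a := mul_pos (Real.sqrt_pos.2 ha) (hpos a le_rfl)
  have h2 : 0 < √(a + Real.pi) * M (a + Real.pi) :=
    mul_pos (Real.sqrt_pos.2 (by linarith)) (hpos _ (by linarith))
  linarith

lemma Bes.step {M M' : ℝ → ℝ} (h : Bes M M') (h0 : M 0 ≠ 0) (c : ℝ) (hc0 : 0 ≤ c)
    (hc : ∀ᶠ x in 𝓝[>] c, 0 < M x) (s : ℝ) (hs : s = sInf {r : ℝ | c < r ∧ M r = 0}) :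
    c < s ∧ (∀ x ∈ Ioo c s, 0 < M x) ∧ ∀ᶠ x in 𝓝[>] s, M x < 0 := by
  have hcont := h.cont
  obtain ⟨u, hu, hsub⟩ := mem_nhdsGT_iff_exists_Ioo_subset.1 hc
  have hu : c < u := hu
  have ivt : ∀ x, c < x → M x ≤ 0 → ∃ y, c < y ∧ y ≤ x ∧ M y = 0 := by
    intro x hx hMx
    set m := (c + min u x) / 2 with hm
    have hlt : c < min u x := lt_min hu hx
    have h1 : c < m := by linarith
    have h2 : m < min u x := by linarith
    have h3 : 0 < M m := hsub ⟨h1, h2.trans_le (min_le_left _ _)⟩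
    have h4 : m ≤ x := h2.le.trans (min_le_right _ _)
    obtain ⟨y, hy, hy0⟩ := intermediate_value_Icc' h4 hcont.continuousOn ⟨hMx, h3.le⟩
    exact ⟨y, h1.trans_le hy.1, hy.2, hy0⟩
  have hne : {r : ℝ | c < r ∧ M r = 0}.Nonempty := by
    by_contra hne
    apply h.sturm (c + 1) (by linarith)
    intro x hx
    by_contra hx'
    obtain ⟨y, hy1, hy2, hy3⟩ := ivt x (by linarith) (not_lt.1 hx')
    exact hne ⟨y, hy1, hy3⟩
  have heq : {r : ℝ | c < r ∧ M r = 0} = {r : ℝ | u ≤ r ∧ M r = 0} := by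
    ext r
    constructor
    · rintro ⟨h1, h2⟩
      refine ⟨?_, h2⟩
      by_contra hlt
      have : 0 < M r := hsub ⟨h1, not_le.1 hlt⟩
      linarith
    · rintro ⟨h1, h2⟩
      exact ⟨by linarith, h2⟩
  have hbdd : BddBelow {r : ℝ | c < r ∧ M r = 0} := ⟨c, fun r hr => hr.1.le⟩
  have hmem : s ∈ {r : ℝ | c < r ∧ M r = 0} := by
    have hcl : IsClosed {r : ℝ | c < r ∧ M r = 0} := by
      rw [heq]
      exact (isClosed_le continuous_const continuous_id).inter (isClosed_eq hcont continuous_const)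
    rw [hs]
    exact hcl.csInf_mem hne hbdd
  have hpos : ∀ x ∈ Ioo c s, 0 < M x := by
    intro x hx
    by_contra hx'
    obtain ⟨y, hy1, hy2, hy3⟩ := ivt x hx.1 (not_lt.1 hx')
    have : s ≤ y := hs ▸ csInf_le hbdd ⟨hy1, hy3⟩
    linarith [hx.2]
  refine ⟨hmem.1, hpos, ?_⟩
  have hM' := h.simple h0 s (hc0.trans_lt hmem.1) hmem.2
  rcases lt_or_gt_of_ne hM' with hneg | hpos'
  · have := eventually_nhdsWithin_sign_eq_of_deriv_neg (f := M) (x₀ := s)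
      (by rw [(h.1 s).deriv]; exact hneg) hmem.2
    filter_upwards [nhdsWithin_le_nhds this, self_mem_nhdsWithin] with x hx hxs
    have hxs : s < x := hxs
    rw [sign_neg (by linarith : s - x < 0)] at hx
    exact sign_eq_neg_one_iff.1 hx
  · exfalso
    have := eventually_nhdsWithin_sign_eq_of_deriv_pos (f := M) (x₀ := s)
      (by rw [(h.1 s).deriv]; exact hpos') hmem.2
    have h2 : ∀ᶠ x in 𝓝[<] s, x ∈ Ioo c s := Ioo_mem_nhdsLT hmem.1
    obtain ⟨x, hx, hxs⟩ := ((this.filter_mono nhdsWithin_le_nhds).and h2).exists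
    have h3 := hpos x hxs
    rw [sign_neg (by linarith [hxs.2] : x - s < 0), sign_eq_neg_one_iff] at hx
    linarith

lemma Bes.smul {M M' : ℝ → ℝ} (h : Bes M M') (c : ℝ) :
    Bes (fun t => c * M t) (fun t => c * M' t) := by
  have := h.lin h (1 - c)
  convert this using 2 <;> ring

lemma zeros_aux {J' : ℝ → ℝ} (h : Bes (besselJ 0) J') (h0 : besselJ 0 0 = 1) (k : ℕ) :
    0 ≤ besselJZero 0 k ∧ (∀ᶠ x in 𝓝[>] (besselJZero 0 k), 0 < (-1) ^ k * besselJ 0 x) ∧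
      ∀ x ∈ Ioo (besselJZero 0 k) (besselJZero 0 (k + 1)), 0 < (-1) ^ k * besselJ 0 x := by
  have key : ∀ k : ℕ, 0 ≤ besselJZero 0 k →
      (∀ᶠ x in 𝓝[>] (besselJZero 0 k), 0 < (-1) ^ k * besselJ 0 x) →
      besselJZero 0 k < besselJZero 0 (k + 1) ∧
      (∀ x ∈ Ioo (besselJZero 0 k) (besselJZero 0 (k + 1)), 0 < (-1) ^ k * besselJ 0 x) ∧
      ∀ᶠ x in 𝓝[>] (besselJZero 0 (k + 1)), (-1) ^ k * besselJ 0 x < 0 := by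
    intro k h1 h2
    refine (h.smul ((-1) ^ k)).step (by simp [h0]) _ h1 h2 _ ?_
    simp [besselJZero]
  induction k with
  | zero =>
    have h1 : 0 ≤ besselJZero 0 0 := le_rfl
    have h2 : ∀ᶠ x in 𝓝[>] (besselJZero 0 0), 0 < (-1) ^ 0 * besselJ 0 x := by
      apply nhdsWithin_le_nhds
      have : ContinuousAt (fun x => (-1) ^ 0 * besselJ 0 x) (besselJZero 0 0) := by
        have := h.cont
        fun_prop
      apply this.eventually (lt_mem_nhds _)
      simp [besselJZero, h0]
    exact ⟨h1, h2, (key 0 h1 h2).2.1⟩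
  | succ k ih =>
    obtain ⟨k1, k2, k3⟩ := key k ih.1 ih.2.1
    have h1 : 0 ≤ besselJZero 0 (k + 1) := ih.1.trans k1.le
    have h2 : ∀ᶠ x in 𝓝[>] (besselJZero 0 (k + 1)), 0 < (-1) ^ (k + 1) * besselJ 0 x := by
      filter_upwards [k3] with x hx
      rw [pow_succ]; linarith
    exact ⟨h1, h2, (key (k + 1) h1 h2).2.1⟩

lemma besselJ_zero_eq (p : ℝ) : besselJ 0 p =
    (1 / (2 * Real.pi)) * ∫ t in (0:ℝ)..(2 * Real.pi), Real.cos ((circ 0 p t) 1) := by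
  have e : ∀ t, (circ 0 p t) 1 = p * Real.sin t := by
    intro t; simp [circ]
  simp only [e, besselJ]
  have hc : ∀ a b : ℝ, IntervalIntegrable (fun t => Real.cos (p * Real.sin t)) volume a b := by
    intro a b; apply Continuous.intervalIntegrable; fun_prop
  rw [← intervalIntegral.integral_add_adjacent_intervals (hc 0 Real.pi) (hc Real.pi (2 * Real.pi))]
  have h2 : ∫ t in Real.pi..(2 * Real.pi), Real.cos (p * Real.sin t)
      = ∫ t in (0:ℝ)..Real.pi, Real.cos (p * Real.sin t) := by
    have := intervalIntegral.integral_comp_add_right (a := 0) (b := Real.pi)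
      (fun t => Real.cos (p * Real.sin t)) Real.pi
    rw [zero_add, ← two_mul] at this
    rw [← this]
    simp
  rw [h2]
  simp
  ring

lemma besselJ_bes : ∃ J', Bes (besselJ 0) J' := by
  have hsm : ContDiff ℝ (⊤ : ℕ∞) (fun y : PlaneE => Real.cos (y 1)) := by fun_prop
  have hf : ∀ y v : PlaneE, fderiv ℝ (fun y : PlaneE => Real.cos (y 1)) y v
      = -Real.sin (y 1) * v 1 := by
    intro y v
    have h1 : HasFDerivAt (fun y : PlaneE => y 1) (EuclideanSpace.proj (𝕜 := ℝ) (1 : Fin 2) : PlaneE →L[ℝ] ℝ) y :=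
      (EuclideanSpace.proj (𝕜 := ℝ) (1 : Fin 2) : PlaneE →L[ℝ] ℝ).hasFDerivAt
    rw [h1.cos.fderiv]
    simp
  have hf2 : ∀ (c : ℝ) (y v : PlaneE), fderiv ℝ (fun y : PlaneE => -Real.sin (y 1) * c) y v
      = -Real.cos (y 1) * v 1 * c := by
    intro c y v
    have h1 : HasFDerivAt (fun y : PlaneE => y 1) (EuclideanSpace.proj (𝕜 := ℝ) (1 : Fin 2) : PlaneE →L[ℝ] ℝ) y :=
      (EuclideanSpace.proj (𝕜 := ℝ) (1 : Fin 2) : PlaneE →L[ℝ] ℝ).hasFDerivAt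
    have h2 : HasFDerivAt (fun y : PlaneE => -Real.sin (y 1) * c) _ y := h1.sin.neg.mul_const c
    rw [h2.fderiv]
    simp
    ring
  obtain ⟨M', hM⟩ := mean_bes hsm (by
    intro x
    simp only [laplacian, hf, hf2, Fin.sum_univ_two]
    simp) 0
  have := hM.smul (1 / (2 * Real.pi))
  rw [show besselJ 0 = fun p => (1 / (2 * Real.pi)) *
    ∫ t in (0:ℝ)..(2 * Real.pi), Real.cos ((circ 0 p t) 1) from funext besselJ_zero_eq]
  exact ⟨_, this⟩

lemma besselJ_zero_zero : besselJ 0 0 = 1 := by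
  simp [besselJ, Real.pi_ne_zero]

lemma mean_eq {F : PlaneE → ℝ} (hF : ContDiff ℝ (⊤ : ℕ∞) F)
    (hEq : ∀ x, laplacian F x + F x = 0) (z : PlaneE) (r : ℝ) (hr : 0 ≤ r) :
    ∫ t in (0:ℝ)..(2 * Real.pi), F (circ z r t) = 2 * Real.pi * F z * besselJ 0 r := by
  obtain ⟨M', hM⟩ := mean_bes hF hEq z
  obtain ⟨J', hJ⟩ := besselJ_bes
  have := (hM.lin hJ (2 * Real.pi * F z)).zero (by simp [besselJ_zero_zero, circ]) r hr
  linarith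

lemma circ_norm (z : PlaneE) (r t : ℝ) (hr : 0 ≤ r) : ‖circ z r t - z‖ = r := by
  have h : ‖circ z r t - z‖ ^ 2 = r ^ 2 := by
    rw [EuclideanSpace.norm_sq_eq]
    simp [circ, Fin.sum_univ_two]
    linear_combination (r ^ 2) * Real.sin_sq_add_cos_sq t
  exact (sq_eq_sq₀ (norm_nonneg _) hr).1 h

lemma circ_surj (z x : PlaneE) (r : ℝ) (hx : ‖x - z‖ = r) : ∃ t, x = circ z r t := by
  set w : ℂ := ⟨(x - z) 0, (x - z) 1⟩ with hw
  have hn : ‖w‖ = r := by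
    have h1 : ‖w‖ ^ 2 = ‖x - z‖ ^ 2 := by
      rw [EuclideanSpace.norm_sq_eq, Complex.sq_norm, Complex.normSq_apply]
      simp [hw, Fin.sum_univ_two]
      ring
    rw [← hx]
    exact (sq_eq_sq₀ (norm_nonneg _) (norm_nonneg _)).1 h1
  refine ⟨w.arg, ?_⟩
  have h1 := Complex.norm_mul_cos_arg w
  have h2 := Complex.norm_mul_sin_arg w
  rw [hn] at h1 h2
  ext i
  fin_cases i
  · simp [circ, h1]; simp [hw]
  · simp [circ, h2]; simp [hw]

/-- Sign of an eigenfunction on a circle where it does not vanish: if `ΔF + F = 0`,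
`J₀(r) ≠ 0` and `F` has no zeros on the circle `|x - z| = r`, then `F(z) ≠ 0` and
`F(x) F(z) J₀(r) > 0` on that circle.  In particular, if
`j_{0,k-1} < r < j_{0,k}`, the sign of `F` on the circle is opposite to the sign of
`F(z)` for `k` even, and equal to it for `k` odd. -/
theorem sign_on_circle_of_eigenfunction
    (F : EuclideanSpace ℝ (Fin 2) → ℝ) (hF : ContDiff ℝ (⊤ : ℕ∞) F)
    (hEq : ∀ x, laplacian F x + F x = 0)
    (z : EuclideanSpace ℝ (Fin 2)) (r : ℝ) (hr : 0 < r)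
    (hJ : besselJ 0 r ≠ 0)
    (hnz : ∀ x, ‖x - z‖ = r → F x ≠ 0) :
    F z ≠ 0 ∧ (∀ x, ‖x - z‖ = r → 0 < F x * F z * besselJ 0 r) ∧
    ∀ k : ℕ, 1 ≤ k → besselJZero 0 (k - 1) < r → r < besselJZero 0 k →
      ∀ x, ‖x - z‖ = r →
        (Even k → F x * F z < 0) ∧ (Odd k → 0 < F x * F z) := by
  have hcirc : Continuous (fun t => F (circ z r t)) :=
    (cont_circ_comp hF.continuous z).comp (by fun_prop : Continuous fun t : ℝ => (r, t))
  have hne : ∀ t, F (circ z r t) ≠ 0 := fun t => hnz _ (circ_norm z r t hr.le)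
  have hsame : ∀ s t, 0 < F (circ z r s) * F (circ z r t) := by
    intro s t
    by_contra hcon
    have hcon := not_lt.1 hcon
    have hmem : (0 : ℝ) ∈ range (fun t => F (circ z r t)) := by
      rcases le_total 0 (F (circ z r s)) with hs | hs
      · have hs' := lt_of_le_of_ne hs (hne s).symm
        have ht : F (circ z r t) ≤ 0 := by
          by_contra ht
          have := mul_pos hs' (not_le.1 ht)
          linarith
        exact mem_range_of_exists_le_of_exists_ge hcirc ⟨t, ht⟩ ⟨s, hs⟩
      · have hs' := lt_of_le_of_ne hs (hne s)
        have ht : 0 ≤ F (circ z r t) := by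
          by_contra ht
          have := mul_pos_of_neg_of_neg hs' (not_le.1 ht)
          linarith
        exact mem_range_of_exists_le_of_exists_ge hcirc ⟨s, hs⟩ ⟨t, ht⟩
    obtain ⟨y, hy⟩ := hmem
    exact hne y hy
  have hmain : ∀ x, ‖x - z‖ = r → 0 < F x * F z * besselJ 0 r := by
    intro x hx
    obtain ⟨s, rfl⟩ := circ_surj z x r hx
    have hpos : 0 < ∫ t in (0:ℝ)..(2 * Real.pi), F (circ z r s) * F (circ z r t) :=
      intervalIntegral.intervalIntegral_pos_of_pos
        ((continuous_const.mul hcirc).intervalIntegrable _ _) (hsame s) Real.two_pi_pos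
    rw [intervalIntegral.integral_const_mul, mean_eq hF hEq z r hr.le] at hpos
    have h2 : F (circ z r s) * (2 * Real.pi * F z * besselJ 0 r)
        = (2 * Real.pi) * (F (circ z r s) * F z * besselJ 0 r) := by ring
    rw [h2] at hpos
    exact (mul_pos_iff_of_pos_left Real.two_pi_pos).1 hpos
  refine ⟨?_, hmain, ?_⟩
  · intro h
    have := hmain _ (circ_norm z r 0 hr.le)
    rw [h] at this
    simp at this
  · intro k hk h1 h2 x hx
    obtain ⟨J', hJ'⟩ := besselJ_bes
    obtain ⟨m, rfl⟩ : ∃ m, k = m + 1 := ⟨k - 1, by omega⟩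
    have hz := (zeros_aux hJ' besselJ_zero_zero m).2.2 r ⟨by simpa using h1, h2⟩
    have hx' := hmain x hx
    constructor
    · intro hev
      have hodd : Odd m := by
        rcases Nat.even_or_odd m with h | h
        · exact absurd hev (by simpa [Nat.even_add_one] using h)
        · exact h
      rw [hodd.neg_one_pow] at hz
      by_contra hcon
      have : F x * F z * besselJ 0 r ≤ 0 :=
        mul_nonpos_of_nonneg_of_nonpos (not_lt.1 hcon) (by linarith)
      linarith
    · intro hod
      have hev : Even m := by
        rcases Nat.even_or_odd m with h | h
        · exact h
        · exact absurd hod (by simpa using h.add_one)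
      rw [hev.neg_one_pow, one_mul] at hz
      exact (mul_pos_iff_of_pos_right hz).1 hx'
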